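/- Let X^1, X^2 be real-valued random variables on a probability space, independent of each other, with |X^j| ≤ 1 almost surely, and let R be a random variable, independent of (X^1, X^2), whose law is the Gaussian distribution N(0, 4·10⁸). Let α₁, α₂, α₃ be nonzero real numbers such that (max_l |α_l|)² ≤ 10 · (min_l |α_l|)². Define X̄ = α₁ X^1 + α₂ X^2 + α₃ R. Then for j = 1, 2, the mutual information satisfies I(X^j ; X̄) ≤ 5·10⁻⁸. -/

import Mathlib

open MeasureTheory ProbabilityTheory
open scoped NNReal Classical

/-- The Kullback–Leibler divergence between two measures, as an extended real number:
it is the integral of the logarithm of the Radon–Nikodym derivative of `μ` with respect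
to `ν`, when `μ ≪ ν` and this logarithm is `μ`-integrable, and `⊤` otherwise. -/
noncomputable def klDiv {α : Type*} [MeasurableSpace α] (μ ν : Measure α) : EReal :=
  if μ ≪ ν ∧ Integrable (fun x => Real.log (μ.rnDeriv ν x).toReal) μ then
    ((∫ x, Real.log (μ.rnDeriv ν x).toReal ∂μ : ℝ) : EReal)
  else ⊤

/-- The mutual information `I(X ; Y)` of two random variables, defined as the
Kullback–Leibler divergence between the joint law of `(X, Y)` and the product of the
marginal laws of `X` and `Y`. -/
noncomputable def mutualInfo {Ω α β : Type*} [MeasurableSpace Ω] [MeasurableSpace α]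
    [MeasurableSpace β] (μ : Measure Ω) (X : Ω → α) (Y : Ω → β) : EReal :=
  klDiv (μ.map (fun ω => (X ω, Y ω))) ((μ.map X).prod (μ.map Y))

open InformationTheory in
/-- For probability measures, the real-valued bound on `klDiv` follows from the bound on
Mathlib's `ℝ≥0∞`-valued divergence. -/
lemma klDiv_le_coe_of_le_ofReal {E : Type*} [MeasurableSpace E] {P Q : Measure E}
    [IsProbabilityMeasure P] [IsProbabilityMeasure Q] {C : ℝ} (hC : 0 ≤ C)
    (h : InformationTheory.klDiv P Q ≤ ENNReal.ofReal C) :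
    _root_.klDiv P Q ≤ (C : EReal) := by
  have hne : InformationTheory.klDiv P Q ≠ ⊤ := ne_top_of_le_ne_top ENNReal.ofReal_ne_top h
  obtain ⟨hac, hint⟩ := klDiv_ne_top_iff.mp hne
  rw [_root_.klDiv, if_pos ⟨hac, hint⟩, EReal.coe_le_coe_iff]
  have hreal := toReal_klDiv_of_measure_eq hac (by simp)
  rw [llr_def] at hreal
  rw [← hreal]
  exact ENNReal.toReal_le_of_le_ofReal hC h

/-- The density of `N(d, s)` with respect to `N(0, s)`. -/
lemma gaussianPDF_eq_mul_exp (d : ℝ) (s : ℝ≥0) (z : ℝ) :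
    gaussianPDF d s z =
      gaussianPDF 0 s z * ENNReal.ofReal (Real.exp ((z * d - d ^ 2 / 2) / s)) := by
  rw [gaussianPDF, gaussianPDF, ← ENNReal.ofReal_mul (gaussianPDFReal_nonneg _ _ _),
    gaussianPDFReal, gaussianPDFReal, mul_assoc (√(2 * Real.pi * s))⁻¹, ← Real.exp_add]
  congr 3
  by_cases hs : (s : ℝ) = 0
  · simp [hs]
  · field_simp
    ring

/-- Shifting a centred Gaussian coordinate by a function `d` of the other coordinate multiplies
the product measure by the Cameron–Martin density. -/
lemma map_shift_prod_gaussianReal {E : Type*} [MeasurableSpace E] (π : Measure E) [SFinite π]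
    {s : ℝ≥0} (hs : s ≠ 0) {d : E → ℝ} (hd : Measurable d) :
    (π.prod (gaussianReal 0 s)).map (fun q => (q.1, q.2 + d q.1)) =
      (π.prod (gaussianReal 0 s)).withDensity
        (fun q => ENNReal.ofReal (Real.exp ((q.2 * d q.1 - d q.1 ^ 2 / 2) / s))) := by
  have hf : Measurable fun q : E × ℝ =>
      ENNReal.ofReal (Real.exp ((q.2 * d q.1 - d q.1 ^ 2 / 2) / s)) := by fun_prop
  refine Measure.ext_of_lintegral _ fun g hg => ?_
  rw [lintegral_map hg (by fun_prop), lintegral_withDensity_eq_lintegral_mul _ hf hg,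
    lintegral_prod _ (by fun_prop), lintegral_prod _ (by fun_prop)]
  refine lintegral_congr fun p => ?_
  have hgp : Measurable fun z => g (p, z) := by fun_prop
  calc ∫⁻ z, g (p, z + d p) ∂gaussianReal 0 s
      = ∫⁻ z, g (p, z) ∂gaussianReal (d p) s := by
        rw [← lintegral_map hgp (measurable_add_const (d p)), gaussianReal_map_add_const, zero_add]
    _ = _ := by
        rw [gaussianReal_of_var_ne_zero _ hs, gaussianReal_of_var_ne_zero _ hs,
          lintegral_withDensity_eq_lintegral_mul _ (measurable_gaussianPDF _ _) hgp,
          lintegral_withDensity_eq_lintegral_mul _ (measurable_gaussianPDF _ _) (by fun_prop)]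
        refine lintegral_congr fun z => ?_
        simp only [Pi.mul_apply, gaussianPDF_eq_mul_exp (d p), mul_assoc]

open InformationTheory in
/-- Shifting a centred Gaussian coordinate of variance `s` by at most `D` costs a divergence of at
most `D² / (2 s)`. -/
lemma klDiv_map_shift_prod_gaussianReal_le {E : Type*} [MeasurableSpace E] (π : Measure E)
    [IsProbabilityMeasure π] {s : ℝ≥0} (hs : s ≠ 0) {d : E → ℝ} (hd : Measurable d) {D : ℝ}
    (hD : ∀ᵐ p ∂π, |d p| ≤ D) :
    InformationTheory.klDiv
      ((π.prod (gaussianReal 0 s)).map (fun q => (q.1, q.2 + d q.1)))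
      (π.prod (gaussianReal 0 s)) ≤ ENNReal.ofReal (D ^ 2 / (2 * s)) := by
  set Q := π.prod (gaussianReal 0 s)
  have hT : Measurable fun q : E × ℝ => (q.1, q.2 + d q.1) := by fun_prop
  set P := Q.map (fun q => (q.1, q.2 + d q.1)) with hP
  have : IsProbabilityMeasure P := Measure.isProbabilityMeasure_map hT.aemeasurable
  have hPQ := map_shift_prod_gaussianReal π hs hd
  have hac : P ≪ Q := by
    rw [hP, hPQ]
    exact withDensity_absolutelyContinuous _ _
  have hDQ : ∀ᵐ q ∂Q, |d q.1| ≤ D := Measure.quasiMeasurePreserving_fst.ae hD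
  have hdQ : Measurable fun q : E × ℝ => d q.1 := by fun_prop
  have hllr : llr P Q =ᵐ[P] fun q => (q.2 * d q.1 - d q.1 ^ 2 / 2) / s := by
    refine hac.ae_le ?_
    have hrn := Measure.rnDeriv_withDensity Q
      (f := fun q => ENNReal.ofReal (Real.exp ((q.2 * d q.1 - d q.1 ^ 2 / 2) / s)))
      (by fun_prop)
    rw [← hPQ] at hrn
    filter_upwards [hrn] with q hq
    rw [llr, hq, ENNReal.toReal_ofReal (Real.exp_pos _).le, Real.log_exp]
  have hz : Integrable (fun q : E × ℝ => q.2) Q :=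
    Integrable.comp_snd ((memLp_id_gaussianReal' 1 (by simp)).integrable le_rfl) π
  have hzd : Integrable (fun q : E × ℝ => q.2 * d q.1) Q :=
    hz.mul_bdd hdQ.aestronglyMeasurable hDQ
  have hd2 : Integrable (fun q : E × ℝ => d q.1 ^ 2) Q := by
    refine Integrable.of_bound (hdQ.pow_const 2).aestronglyMeasurable (D ^ 2) ?_
    filter_upwards [hDQ] with q hq
    rw [Real.norm_eq_abs, abs_pow]
    gcongr
  have hcomp : (fun q : E × ℝ => ((q.2 + d q.1) * d q.1 - d q.1 ^ 2 / 2) / s) =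
      fun q => (q.2 * d q.1 + d q.1 ^ 2 / 2) / s := by
    funext q
    ring
  have hmeas : AEStronglyMeasurable (fun q : E × ℝ => (q.2 * d q.1 - d q.1 ^ 2 / 2) / s) P := by
    fun_prop
  have hint : Integrable (llr P Q) P := by
    rw [integrable_congr hllr, hP, integrable_map_measure (hP ▸ hmeas) hT.aemeasurable]
    change Integrable (fun q : E × ℝ => ((q.2 + d q.1) * d q.1 - d q.1 ^ 2 / 2) / s) Q
    rw [hcomp]
    exact (hzd.add (hd2.div_const 2)).div_const _
  have hzero : ∫ q, q.2 * d q.1 ∂Q = 0 := by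
    rw [integral_prod_symm _ hzd]
    simp [integral_mul_const, integral_const_mul, integral_id_gaussianReal]
  rw [klDiv_of_ac_of_integrable hac hint]
  simp only [probReal_univ, add_sub_cancel_right]
  refine ENNReal.ofReal_le_ofReal ?_
  rw [integral_congr_ae hllr, hP, integral_map hT.aemeasurable (hP ▸ hmeas)]
  simp only [hcomp]
  rw [integral_div, integral_add hzd (hd2.div_const 2), hzero, zero_add, integral_div, div_div]
  gcongr
  calc ∫ q, d q.1 ^ 2 ∂Q ≤ ∫ _, D ^ 2 ∂Q := by
        refine integral_mono_ae hd2 (integrable_const _) ?_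
        filter_upwards [hDQ] with q hq
        exact sq_le_sq' (abs_le.mp hq).1 (abs_le.mp hq).2
    _ = D ^ 2 := by simp

/-- The mutual information between a bounded variable `X` and `a X + Y + Z`, with `Y` and a centred
Gaussian `Z` of variance `s` independent of each other and of `X`, is at most `2 a² / s`. -/
lemma mutualInfo_add_gaussian_le {Ω : Type*} [MeasurableSpace Ω] (μ : Measure Ω)
    [IsProbabilityMeasure μ] {X Y Z : Ω → ℝ} (hX : Measurable X) (hY : Measurable Y)
    (hZ : Measurable Z) (hb : ∀ᵐ ω ∂μ, |X ω| ≤ 1) {s : ℝ≥0} (hs : s ≠ 0)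
    (hZlaw : μ.map Z = gaussianReal 0 s) (hXY : IndepFun X Y μ)
    (hXYZ : IndepFun (fun ω => (X ω, Y ω)) Z μ) (a : ℝ) :
    mutualInfo μ X (fun ω => a * X ω + Y ω + Z ω) ≤ ((2 * a ^ 2 / s : ℝ) : EReal) := by
  set νX := μ.map X with hνX
  set νY := μ.map Y with hνY
  set G := gaussianReal 0 s
  have : IsProbabilityMeasure νX := Measure.isProbabilityMeasure_map hX.aemeasurable
  have : IsProbabilityMeasure νY := Measure.isProbabilityMeasure_map hY.aemeasurable
  have hlaw : μ.map (fun ω => ((X ω, Y ω), Z ω)) = (νX.prod νY).prod G := by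
    rw [hXYZ.map_prod_eq_prod_map_map (by fun_prop) (by fun_prop),
      hXY.map_prod_eq_prod_map_map (by fun_prop) (by fun_prop), hZlaw]
  set W : (ℝ × ℝ) × ℝ → ℝ := fun q => a * q.1.1 + q.1.2 + q.2 with hW
  have hWm : Measurable W := by fun_prop
  have hWlaw : μ.map (fun ω => a * X ω + Y ω + Z ω) = ((νX.prod νY).prod G).map W := by
    rw [← hlaw, Measure.map_map hWm (by fun_prop)]
    rfl
  have hjoint : μ.map (fun ω => (X ω, a * X ω + Y ω + Z ω)) =
      ((νX.prod νY).prod G).map (fun q => (q.1.1, W q)) := by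
    rw [← hlaw, Measure.map_map (by fun_prop) (by fun_prop)]
    rfl
  set π := νX.prod (νX.prod νY)
  set d : ℝ × (ℝ × ℝ) → ℝ := fun p => a * (p.1 - p.2.1) with hd
  have hdm : Measurable d := by fun_prop
  have hbX : ∀ᵐ x ∂νX, |x| ≤ 1 :=
    (ae_map_iff hX.aemeasurable (measurableSet_le (by fun_prop) (by fun_prop))).mpr hb
  have hD : ∀ᵐ p ∂π, |d p| ≤ 2 * |a| := by
    have h1 : ∀ᵐ p ∂π, |p.1| ≤ 1 := Measure.quasiMeasurePreserving_fst.ae hbX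
    have h2 : ∀ᵐ p ∂π, |p.2.1| ≤ 1 :=
      (Measure.quasiMeasurePreserving_fst.comp Measure.quasiMeasurePreserving_snd).ae hbX
    filter_upwards [h1, h2] with p hp1 hp2
    rw [hd, abs_mul, mul_comm]
    gcongr
    exact (abs_sub _ _).trans (by linarith)
  have hkl := klDiv_map_shift_prod_gaussianReal_le π hs hdm hD
  set g : (ℝ × (ℝ × ℝ)) × ℝ → ℝ × ℝ := fun q => (q.1.1, W (q.1.2, q.2)) with hg
  have hgm : Measurable g := by fun_prop
  have hgQ : (π.prod G).map g = νX.prod (((νX.prod νY).prod G).map W) := by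
    rw [← Measure.map_id (μ := νX), Measure.map_prod_map _ _ measurable_id hWm, Measure.map_id,
      ← Measure.prodAssoc_prod, Measure.map_map (by fun_prop) (by fun_prop)]
    rfl
  have hgP : ((π.prod G).map (fun q => (q.1, q.2 + d q.1))).map g =
      ((νX.prod νY).prod G).map (fun q => (q.1.1, W q)) := by
    rw [Measure.map_map hgm (by fun_prop)]
    refine Measure.ext_of_lintegral _ fun f hf => ?_
    rw [lintegral_map hf (by fun_prop), lintegral_map hf (by fun_prop),
      lintegral_prod _ (by fun_prop), lintegral_prod _ (by fun_prop),
      lintegral_prod _ (by fun_prop), lintegral_prod _ (by fun_prop)]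
    refine lintegral_congr fun x => ?_
    rw [lintegral_prod _ (by fun_prop)]
    have hval : ∀ x' y z, (g ∘ fun q => (q.1, q.2 + d q.1)) ((x, (x', y)), z) =
        (x, W ((x, y), z)) := by
      intro x' y z
      simp only [hg, hW, hd, Function.comp_apply, Prod.mk.injEq, true_and]
      ring
    simp only [hval]
    simp
  have hdpi := (InformationTheory.klDiv_map_le _ _ hgm).trans hkl
  rw [hgP, hgQ, ← hjoint, ← hWlaw] at hdpi
  have : IsProbabilityMeasure (μ.map (fun ω => (X ω, a * X ω + Y ω + Z ω))) :=
    Measure.isProbabilityMeasure_map (by fun_prop)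
  have : IsProbabilityMeasure (μ.map (fun ω => a * X ω + Y ω + Z ω)) :=
    Measure.isProbabilityMeasure_map (by fun_prop)
  refine (klDiv_le_coe_of_le_ofReal (by positivity) hdpi).trans_eq ?_
  rw [mul_pow, sq_abs]
  congr 1
  have hs0 : (s : ℝ) ≠ 0 := by exact_mod_cast hs
  field_simp

/-- **Numerical instance of the leakage bound.**  If `X^1, X^2` are independent real random
variables bounded by `1`, `R` is an independent Gaussian `N(0, 4·10⁸)` noise, and the nonzero
coefficients satisfy `(max |α l|)² ≤ 10 (min |α l|)²`, then with
`X̄ = α₁ X^1 + α₂ X^2 + α₃ R` we have `I(X^j ; X̄) ≤ 5·10⁻⁸` for `j = 1, 2`. -/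
theorem info_leakage_numerical {Ω : Type*} [MeasurableSpace Ω] (μ : Measure Ω)
    [IsProbabilityMeasure μ] (X : Fin 2 → Ω → ℝ) (R : Ω → ℝ)
    (hXm : ∀ j, Measurable (X j)) (hRm : Measurable R)
    (hbound : ∀ j, ∀ᵐ ω ∂μ, |X j ω| ≤ 1)
    (hRlaw : μ.map R = gaussianReal 0 (4e8 : ℝ≥0))
    (hXindep : IndepFun (X 0) (X 1) μ)
    (hRindep : IndepFun R (fun ω => fun j => X j ω) μ)
    (α : Fin 3 → ℝ) (hα0 : ∀ l, α l ≠ 0)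
    (hratio : (⨆ l, |α l|) ^ 2 ≤ 10 * (⨅ l, |α l|) ^ 2)
    (Xbar : Ω → ℝ)
    (hXbar : Xbar = fun ω => α 0 * X 0 ω + α 1 * X 1 ω + α 2 * R ω) :
    ∀ j : Fin 2, mutualInfo μ (X j) Xbar ≤ ((5e-8 : ℝ) : EReal) := by
  have hiSup : ∀ l, |α l| ≤ ⨆ l, |α l| := le_ciSup (Set.finite_range _).bddAbove
  have hiInf : ∀ l, ⨅ l, |α l| ≤ |α l| := ciInf_le (Set.finite_range _).bddBelow
  have hiInf0 : 0 ≤ ⨅ l, |α l| := le_ciInf fun l => abs_nonneg _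
  have hsq : ∀ l, α l ^ 2 ≤ 10 * α 2 ^ 2 := fun l => by
    rw [← sq_abs (α l), ← sq_abs (α 2)]
    have h1 := pow_le_pow_left₀ (abs_nonneg _) (hiSup l) 2
    have h2 := pow_le_pow_left₀ hiInf0 (hiInf 2) 2
    linarith
  set s : ℝ≥0 := .mk (α 2 ^ 2) (sq_nonneg _) * 4e8 with hs
  have hsR : (s : ℝ) = α 2 ^ 2 * 4e8 := by
    rw [hs, NNReal.coe_mul]
    norm_num
  have hα2 : 0 < α 2 ^ 2 := by have := hα0 2; positivity
  have hs0 : s ≠ 0 := by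
    have : (s : ℝ) ≠ 0 := by rw [hsR]; positivity
    exact_mod_cast this
  have hZlaw : μ.map (fun ω => α 2 * R ω) = gaussianReal 0 s := by
    have h := gaussianReal_map_const_mul (μ := 0) (v := 4e8) (α 2)
    rw [mul_zero, ← hRlaw, Measure.map_map (by fun_prop) hRm] at h
    exact h
  have key : ∀ (i j : Fin 2) (k l : Fin 3), IndepFun (X i) (X j) μ →
      mutualInfo μ (X i) (fun ω => α k * X i ω + α l * X j ω + α 2 * R ω) ≤
        ((5e-8 : ℝ) : EReal) := fun i j k l hij => by
    have hXi := hXm i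
    have hXj := hXm j
    have hindep : IndepFun (fun ω => (X i ω, α l * X j ω)) (fun ω => α 2 * R ω) μ :=
      hRindep.symm.comp (φ := fun x : Fin 2 → ℝ => (x i, α l * x j)) (ψ := fun r => α 2 * r)
        (by fun_prop) (by fun_prop)
    refine (mutualInfo_add_gaussian_le μ hXi (by fun_prop) (by fun_prop) (hbound i) hs0 hZlaw
      (hij.comp measurable_id (measurable_const_mul (α l))) hindep (α k)).trans ?_
    rw [EReal.coe_le_coe_iff, hsR, div_le_iff₀ (by positivity)]
    linarith [hsq k]
  subst hXbar
  intro j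
  fin_cases j
  · exact key 0 1 0 1 hXindep
  · have h := key 1 0 1 0 hXindep.symm
    simp only [add_comm (α 1 * X 1 _)] at h
    exact h
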